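/- Let G be a finite simple vdec graph (at most one isolated vertex and no isolated edge). Then χ'_vd(G) ≤ |V(G)| + 1; that is, G admits a vertex-distinguishing edge-(|V(G)|+1)-coloring. -/

import Mathlib

/-- `φ` is a proper edge-`k`-coloring of `G`: every edge gets a color in `{1,…,k}` and
adjacent (distinct, sharing a vertex) edges get different colors. -/
def IsEdgeKColoring {V : Type*} (G : SimpleGraph V) (k : ℕ) (φ : Sym2 V → ℕ) : Prop :=
  (∀ e ∈ G.edgeSet, φ e ∈ Finset.Icc 1 k) ∧
  ∀ e₁ ∈ G.edgeSet, ∀ e₂ ∈ G.edgeSet, e₁ ≠ e₂ → (∃ v : V, v ∈ e₁ ∧ v ∈ e₂) → φ e₁ ≠ φ e₂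

/-- The color-set of a vertex `v`: the set of colors appearing on edges incident with `v`. -/
def colorSet {V : Type*} (G : SimpleGraph V) (φ : Sym2 V → ℕ) (v : V) : Set ℕ :=
  {c | ∃ e ∈ G.edgeSet, v ∈ e ∧ φ e = c}

/-- A vertex-distinguishing edge-`k`-coloring. -/
def IsVDEC {V : Type*} (G : SimpleGraph V) (k : ℕ) (φ : Sym2 V → ℕ) : Prop :=
  IsEdgeKColoring G k φ ∧ ∀ u v : V, u ≠ v → colorSet G φ u ≠ colorSet G φ v

/-- The vertex-distinguishing chromatic index: the least `k` admitting a `k`-vdec. -/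
noncomputable def vdIndex {V : Type*} (G : SimpleGraph V) : ℕ :=
  sInf {k | ∃ φ : Sym2 V → ℕ, IsVDEC G k φ}

/-- `k(G)`: the least `k` such that `C(k,d) ≥ n_d` for every `d ∈ [δ(G), Δ(G)]`,
where `n_d` is the number of vertices of degree `d`. -/
noncomputable def paramK {V : Type*} [Fintype V] (G : SimpleGraph V) [DecidableRel G.Adj] : ℕ :=
  sInf {k | ∀ d : ℕ, G.minDegree ≤ d → d ≤ G.maxDegree →
    (Finset.univ.filter (fun v => G.degree v = d)).card ≤ k.choose d}

/-- A graph is vdec if it has at most one isolated vertex and no isolated edge. -/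
def IsVdecGraph {V : Type*} [Fintype V] (G : SimpleGraph V) [DecidableRel G.Adj] : Prop :=
  {v : V | G.degree v = 0}.Subsingleton ∧
  ¬ ∃ u v : V, G.Adj u v ∧ G.degree u = 1 ∧ G.degree v = 1

open Function in
/-- A sliding game: the states are assignments `c : D → Ω` of colors to positions, `B` marks the
blocked assignments, `R` the reachable ones, `M i` is a set of target colors at position `i`, and
the weight `v` controls which moves are possible. No reachable state admits a winning move. -/
structure SlidingGame {D Ω Q : Type*} [Fintype D] [DecidableEq D] [AddCommGroup Q] [Module ℚ Q]
    (v : Ω → Q) (f : Q →ₗ[ℚ] ℚ) (B R : (D → Ω) → Prop) (P : D → Prop) (M : D → Set Ω) :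
    Prop where
  aff : ∀ a, f (v a) = 1
  spanning : ∀ q₁ q₂ q₃, ∃ a, v a ∉ Submodule.span ℚ {q₁, q₂, q₃}
  range_congr : ∀ c c', Set.range c = Set.range c' → B c → B c'
  sum_eq : ∀ c c', Injective c → Injective c' → B c → B c' → ∑ i, v (c i) = ∑ i, v (c' i)
  inj : ∀ c, R c → Injective c
  not_blocked : ∀ c, R c → ¬ B c
  not_mem : ∀ c i, R c → P i → c i ∉ M i
  move : ∀ c i b, R c → b ∉ Set.range c → v (c i) ≠ v b → ¬ B (update c i b) → R (update c i b)
  no_win : ∀ c i γ, R c → P i → γ ∈ M i → γ ∉ Set.range c → v (c i) ≠ v γ → B (update c i γ)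

namespace SlidingGame

open Function

theorem mem_range_update {D Ω : Type*} [DecidableEq D] {c : D → Ω} (hc : Injective c)
    (i : D) (b a : Ω) : a ∈ Set.range (update c i b) ↔ a = b ∨ (a ∈ Set.range c ∧ a ≠ c i) := by
  constructor
  · rintro ⟨j, rfl⟩
    by_cases h : j = i
    · subst h; simp
    · right
      rw [update_of_ne h]
      exact ⟨⟨j, rfl⟩, fun e => h (hc e)⟩
  · rintro (rfl | ⟨⟨j, rfl⟩, h⟩)
    · exact ⟨i, by simp⟩
    · refine ⟨j, ?_⟩
      rw [update_of_ne]
      rintro rfl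
      exact h rfl

theorem injective_update {D Ω : Type*} [DecidableEq D] {c : D → Ω} (hc : Injective c)
    (i : D) {b : Ω} (hb : b ∉ Set.range c) : Injective (update c i b) := by
  intro j k h
  by_cases hj : j = i <;> by_cases hk : k = i
  · rw [hj, hk]
  · subst hj
    rw [update_self, update_of_ne hk] at h
    exact absurd ⟨k, h.symm⟩ hb
  · subst hk
    rw [update_self, update_of_ne hj] at h
    exact absurd ⟨j, h⟩ hb
  · rw [update_of_ne hj, update_of_ne hk] at h
    exact hc h

theorem sum_update {D Ω Q : Type*} [Fintype D] [DecidableEq D] [AddCommGroup Q]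
    (v : Ω → Q) (c : D → Ω) (i : D) (b : Ω) :
    ∑ k, v (update c i b k) = ∑ k, v (c k) - v (c i) + v b := by
  rw [← Finset.add_sum_erase _ _ (Finset.mem_univ i), ← Finset.add_sum_erase (a := i) _
    (fun k => v (c k)) (Finset.mem_univ i), update_self]
  rw [Finset.sum_congr rfl (g := fun k => v (c k))]
  · abel
  · intro k hk
    rw [update_of_ne (Finset.ne_of_mem_erase hk)]

variable {D Ω Q : Type*} [Fintype D] [DecidableEq D] [AddCommGroup Q] [Module ℚ Q]
  {v : Ω → Q} {f : Q →ₗ[ℚ] ℚ} {B R : (D → Ω) → Prop} {P : D → Prop} {M : D → Set Ω}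

/-- Two blocked moves out of the same state have the same weight difference. -/
theorem blocked_sub_eq (h : SlidingGame v f B R P M) {c : D → Ω} (hc : Injective c) {i j : D}
    {a b : Ω} (ha : a ∉ Set.range c) (hb : b ∉ Set.range c) (hi : B (update c i a))
    (hj : B (update c j b)) : v a - v (c i) = v b - v (c j) := by
  have := h.sum_eq _ _ (injective_update hc i ha) (injective_update hc j hb) hi hj
  rw [sum_update, sum_update, sub_add_eq_add_sub, sub_add_eq_add_sub, add_sub_assoc,
    add_sub_assoc] at this
  exact add_left_cancel this

/-- A target of a position that is a hole has the weight of the color at that position. -/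
theorem no_hole_target (h : SlidingGame v f B R P M) (hD : ∀ i : D, ∃ j, j ≠ i)
    (hH : ∀ c : D → Ω, ∀ a, ∃ b, b ∉ Set.range c ∧ b ≠ a) {c : D → Ω} (hc : R c) {i : D}
    (hi : P i) {γ : Ω} (hγ : γ ∈ M i) (hγc : γ ∉ Set.range c) : v γ = v (c i) := by
  by_contra hne
  have hinj := h.inj c hc
  have hb := h.no_win c i γ hc hi hγ hγc (Ne.symm hne)
  have key : ∃ j β, j ≠ i ∧ β ≠ γ ∧ β ∉ Set.range c ∧ v (c j) ≠ v β ∧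
      v β - v (c j) ≠ v γ - v (c i) := by
    by_contra! hno
    obtain ⟨j₀, hj₀⟩ := hD i
    obtain ⟨β₀, hβ₀, hβγ⟩ := hH c γ
    obtain ⟨a, ha⟩ := h.spanning (v β₀) (v γ) (v (c i))
    apply ha
    have tok : ∀ j, v (c j) ∈ Submodule.span ℚ {v β₀, v γ, v (c i)} := by
      intro j
      by_cases hj : j = i
      · subst hj
        exact Submodule.subset_span (by simp)
      · by_cases e : v (c j) = v β₀
        · rw [e]
          exact Submodule.subset_span (by simp)
        · have := hno j β₀ hj hβγ hβ₀ e
          have e2 : v (c j) = v β₀ - v γ + v (c i) := by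
            rw [sub_eq_iff_eq_add] at this
            rw [this]; abel
          rw [e2]
          exact add_mem (sub_mem (Submodule.subset_span (by simp))
            (Submodule.subset_span (by simp))) (Submodule.subset_span (by simp))
    by_cases har : a ∈ Set.range c
    · obtain ⟨j, rfl⟩ := har
      exact tok j
    · by_cases e : a = γ
      · subst e
        exact Submodule.subset_span (by simp)
      · by_cases e1 : v (c j₀) = v a
        · rw [← e1]
          exact tok j₀
        · have := hno j₀ a hj₀ e har e1
          rw [sub_eq_iff_eq_add] at this
          rw [this]
          exact add_mem (sub_mem (Submodule.subset_span (by simp))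
            (Submodule.subset_span (by simp))) (tok j₀)
  obtain ⟨j, β, hji, hβγ, hβ, hv, hd⟩ := key
  have hB : ¬ B (update c j β) := fun hB => hd (h.blocked_sub_eq hinj hβ hγc hB hb)
  have hR := h.move c j β hc hβ hv hB
  have hγ' : γ ∉ Set.range (update c j β) := by
    rw [mem_range_update hinj]
    rintro (e | ⟨e, -⟩)
    · exact hβγ e.symm
    · exact hγc e
  have hij : update c j β i = c i := update_of_ne (Ne.symm hji) _ _
  have hb2 := h.no_win _ i γ hR hi hγ hγ' (by rw [hij]; exact Ne.symm hne)
  have := h.sum_eq _ _ (injective_update hinj i hγc)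
    (injective_update (h.inj _ hR) i hγ') hb hb2
  rw [sum_update, sum_update, sum_update, hij] at this
  apply hv
  have e : v β = v (c j) + ((∑ k, v (c k) - v (c j) + v β - v (c i) + v γ) -
    (∑ k, v (c k) - v (c i) + v γ)) := by abel
  rw [e, ← this]; abel

/-- The targets of a position that can be moved are not holes. -/
theorem target_mem_of_movable (h : SlidingGame v f B R P M) (hD : ∀ i : D, ∃ j, j ≠ i)
    (hH : ∀ c : D → Ω, ∀ a, ∃ b, b ∉ Set.range c ∧ b ≠ a) {c : D → Ω} (hc : R c) {i : D}
    (hi : P i) {b : Ω} (hb : b ∉ Set.range c) (hv : v (c i) ≠ v b) (hB : ¬ B (update c i b))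
    {γ : Ω} (hγ : γ ∈ M i) : γ ∈ Set.range c := by
  by_contra hγc
  have e := h.no_hole_target hD hH hc hi hγ hγc
  have hR := h.move c i b hc hb hv hB
  have := h.no_hole_target hD hH hR hi hγ (by
    rw [mem_range_update (h.inj c hc)]
    rintro (e' | ⟨e', -⟩)
    · subst e'; exact hv e.symm
    · exact hγc e')
  rw [update_self] at this
  exact hv (e.symm.trans this)

/-- If positions `i` and `l` can both be moved to the hole `a` and the three weights are distinct,
then every target of `i` is a color whose replacement by `a` is blocked. -/
theorem blocked_of_target (h : SlidingGame v f B R P M) (hD : ∀ i : D, ∃ j, j ≠ i)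
    (hH : ∀ c : D → Ω, ∀ a, ∃ b, b ∉ Set.range c ∧ b ≠ a) {c : D → Ω} (hc : R c) {i l : D}
    (hi : P i) {a : Ω} (ha : a ∉ Set.range c) (hia : v (c i) ≠ v a) (hla : v (c l) ≠ v a)
    (hil : v (c i) ≠ v (c l)) (hBi : ¬ B (update c i a)) (hBl : ¬ B (update c l a))
    {γ : Ω} (hγ : γ ∈ M i) : ∃ j, c j = γ ∧ B (update c j a) := by
  obtain ⟨j, rfl⟩ := h.target_mem_of_movable hD hH hc hi ha hia hBi hγ
  refine ⟨j, rfl, ?_⟩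
  by_contra hBj
  have hinj := h.inj c hc
  have hji : j ≠ i := by
    rintro rfl
    exact h.not_mem c _ hc hi hγ
  have hli : l ≠ i := by
    rintro rfl
    exact hil rfl
  by_cases h1 : v (c j) = v (c i)
  · -- rotate `i`, `l`, `j`
    have hjl : j ≠ l := by
      rintro rfl
      exact hil h1.symm
    have R1 := h.move c i a hc ha hia hBi
    have n1 : c i ∉ Set.range (update c i a) := by
      rw [mem_range_update hinj]
      rintro (e | ⟨-, e⟩)
      · exact ha ⟨i, e⟩
      · exact e rfl
    have R2 := h.move _ l (c i) R1 n1 (by rw [update_of_ne hli]; exact Ne.symm hil) (by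
      refine fun hB => hBl (h.range_congr _ _ ?_ hB)
      ext t
      rw [mem_range_update (h.inj _ R1), mem_range_update hinj, mem_range_update hinj,
        update_of_ne hli]
      have := @hinj i l
      grind)
    have hr : ∀ t, t ∈ Set.range (update (update c i a) l (c i)) ↔
        t = a ∨ t ∈ Set.range c ∧ t ≠ c l := by
      intro t
      rw [mem_range_update (h.inj _ R1), mem_range_update hinj, update_of_ne hli]
      have := @hinj i l
      grind
    have n2 : c l ∉ Set.range (update (update c i a) l (c i)) := by
      rw [hr]
      rintro (e | ⟨-, e⟩)
      · exact ha ⟨l, e⟩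
      · exact e rfl
    have ej : update (update c i a) l (c i) j = c j := by
      rw [update_of_ne hjl, update_of_ne hji]
    have R3 := h.move _ j (c l) R2 n2 (by rw [ej, h1]; exact hil) (by
      refine fun hB => hBj (h.range_congr _ _ ?_ hB)
      ext t
      rw [mem_range_update (h.inj _ R2), hr, mem_range_update hinj, ej]
      have := @hinj j l
      grind)
    have := h.no_hole_target hD hH R3 hi hγ (by
      rw [mem_range_update (h.inj _ R2), hr, ej]
      have := @hinj j l
      grind)
    rw [update_of_ne (Ne.symm hji), update_of_ne (Ne.symm hli), update_self] at this
    exact hia (h1.symm.trans this)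
  · by_cases h2 : v (c j) = v a
    · have hjl : j ≠ l := by
        rintro rfl
        exact hla h2
      have R1 := h.move c l a hc ha hla hBl
      have n1 : c l ∉ Set.range (update c l a) := by
        rw [mem_range_update hinj]
        rintro (e | ⟨-, e⟩)
        · exact ha ⟨l, e⟩
        · exact e rfl
      have R2 := h.move _ j (c l) R1 n1 (by
          rw [update_of_ne hjl, h2]; exact Ne.symm hla) (by
        refine fun hB => hBj (h.range_congr _ _ ?_ hB)
        ext t
        rw [mem_range_update (h.inj _ R1), mem_range_update hinj, mem_range_update hinj,
          update_of_ne hjl]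
        have := @hinj j l
        grind)
      have := h.no_hole_target hD hH R2 hi hγ (by
        rw [mem_range_update (h.inj _ R1), mem_range_update hinj, update_of_ne hjl]
        have := @hinj j l
        grind)
      rw [update_of_ne (Ne.symm hji), update_of_ne (Ne.symm hli)] at this
      exact h1 this
    · have R1 := h.move c j a hc ha h2 hBj
      have := h.no_hole_target hD hH R1 hi hγ (by
        rw [mem_range_update hinj]
        rintro (e | ⟨-, e⟩)
        · exact h2 (by rw [e])
        · exact e rfl)
      rw [update_of_ne (Ne.symm hji)] at this
      exact h1 this

/-- Exchange of the colors of two positions through a hole. -/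
theorem exchange (h : SlidingGame v f B R P M) {c : D → Ω} (hc : R c) {i l : D}
    {a : Ω} (ha : a ∉ Set.range c) (hia : v (c i) ≠ v a) (hla : v (c l) ≠ v a)
    (hil : v (c i) ≠ v (c l)) (hBi : ¬ B (update c i a)) (hBl : ¬ B (update c l a)) :
    ∃ c', R c' ∧ Set.range c' = Set.range c ∧ c' i = c l ∧ c' l = c i := by
  have hinj := h.inj c hc
  have hli : l ≠ i := by
    rintro rfl
    exact hil rfl
  have R1 := h.move c i a hc ha hia hBi
  have n1 : c i ∉ Set.range (update c i a) := by
    rw [mem_range_update hinj]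
    rintro (e | ⟨-, e⟩)
    · exact ha ⟨i, e⟩
    · exact e rfl
  have hr : ∀ t, t ∈ Set.range (update (update c i a) l (c i)) ↔
      t = a ∨ t ∈ Set.range c ∧ t ≠ c l := by
    intro t
    rw [mem_range_update (h.inj _ R1), mem_range_update hinj, update_of_ne hli]
    have := @hinj i l
    grind
  have R2 := h.move _ l (c i) R1 n1 (by rw [update_of_ne hli]; exact Ne.symm hil) (by
    refine fun hB => hBl (h.range_congr _ _ ?_ hB)
    ext t
    rw [hr, mem_range_update hinj])
  have n2 : c l ∉ Set.range (update (update c i a) l (c i)) := by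
    rw [hr]
    rintro (e | ⟨-, e⟩)
    · exact ha ⟨l, e⟩
    · exact e rfl
  have ei : update (update c i a) l (c i) i = a := by
    rw [update_of_ne (Ne.symm hli), update_self]
  have er : Set.range (update (update (update c i a) l (c i)) i (c l)) = Set.range c := by
    ext t
    rw [mem_range_update (h.inj _ R2), hr, ei]
    have : c l ∈ Set.range c := ⟨l, rfl⟩
    grind
  have R3 := h.move _ i (c l) R2 n2 (by rw [ei]; exact Ne.symm hla)
    (fun hB => h.not_blocked c hc (h.range_congr _ _ er hB))
  refine ⟨_, R3, er, by simp, ?_⟩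
  rw [update_of_ne hli, update_self]

/-- There is a reachable state whose colors, and whose holes, take two weights each. -/
theorem exists_two_weights (h : SlidingGame v f B R P M) (hD : ∀ i : D, ∃ j, j ≠ i)
    [Nonempty D]
    (hH : ∀ c : D → Ω, ∀ a, ∃ b, b ∉ Set.range c ∧ b ≠ a) {c₀ : D → Ω} (hc₀ : R c₀) :
    ∃ c, R c ∧ (∃ i l, v (c i) ≠ v (c l)) ∧
      ∃ u ∉ Set.range c, ∃ u' ∉ Set.range c, v u ≠ v u' := by
  have hinj := h.inj c₀ hc₀
  by_cases h1 : ∃ i l, v (c₀ i) ≠ v (c₀ l)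
  · by_cases h2 : ∃ u ∉ Set.range c₀, ∃ u' ∉ Set.range c₀, v u ≠ v u'
    · exact ⟨c₀, hc₀, h1, h2⟩
    · push Not at h2
      obtain ⟨i₀⟩ := ‹Nonempty D›
      obtain ⟨u, hu, -⟩ := hH c₀ (c₀ i₀)
      obtain ⟨u', hu', huu⟩ := hH c₀ u
      obtain ⟨d₁, h₁⟩ := h.spanning (v u) (v u) (v u)
      obtain ⟨d₂, h₂⟩ := h.spanning (v u) (v d₁) (v d₁)
      obtain ⟨d₃, h₃⟩ := h.spanning (v u) (v d₁) (v d₂)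
      have tok : ∀ d, v d ≠ v u → ∃ k, c₀ k = d := by
        intro d hd
        by_contra hn
        exact hd (h2 d hn u hu)
      have a₁ : v d₁ ≠ v u := fun e => h₁ (e ▸ Submodule.subset_span (by simp))
      have a₂ : v d₂ ≠ v u := fun e => h₂ (e ▸ Submodule.subset_span (by simp))
      have a₃ : v d₃ ≠ v u := fun e => h₃ (e ▸ Submodule.subset_span (by simp))
      have a₂₁ : v d₂ ≠ v d₁ := fun e => h₂ (e ▸ Submodule.subset_span (by simp))
      have a₃₁ : v d₃ ≠ v d₁ := fun e => h₃ (e ▸ Submodule.subset_span (by simp))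
      have a₃₂ : v d₃ ≠ v d₂ := fun e => h₃ (e ▸ Submodule.subset_span (by simp))
      obtain ⟨k₁, rfl⟩ := tok d₁ a₁
      obtain ⟨k₂, rfl⟩ := tok d₂ a₂
      obtain ⟨k₃, rfl⟩ := tok d₃ a₃
      have fin : ∀ k, v (c₀ k) ≠ v u → v (c₀ k₃) ≠ v (c₀ k) → ¬ B (update c₀ k u) →
          ∃ c, R c ∧ (∃ i l, v (c i) ≠ v (c l)) ∧
          ∃ u ∉ Set.range c, ∃ u' ∉ Set.range c, v u ≠ v u' := by
        intro k hk hk₃ hB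
        refine ⟨_, h.move c₀ k u hc₀ hu hk hB, ⟨k₃, k, ?_⟩, c₀ k, ?_, u', ?_, ?_⟩
        · rw [update_self, update_of_ne]
          · exact a₃
          · rintro rfl
            exact hk₃ rfl
        · rw [mem_range_update hinj]
          rintro (e | ⟨-, e⟩)
          · exact hu ⟨k, e⟩
          · exact e rfl
        · rw [mem_range_update hinj]
          rintro (e | ⟨e, -⟩)
          · exact huu e
          · exact hu' e
        · rw [h2 u' hu' u hu]
          exact hk
      by_cases hB : B (update c₀ k₁ u)
      · refine fin k₂ a₂ a₃₂ fun hB' => a₂₁ ?_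
        have := h.blocked_sub_eq hinj hu hu hB hB'
        exact (sub_right_inj.mp this).symm
      · exact fin k₁ a₁ a₃₁ hB
  · push Not at h1
    obtain ⟨i⟩ := ‹Nonempty D›
    obtain ⟨j, hji⟩ := hD i
    obtain ⟨d₁, h₁⟩ := h.spanning (v (c₀ i)) (v (c₀ i)) (v (c₀ i))
    obtain ⟨d₂, h₂⟩ := h.spanning (v (c₀ i)) (v d₁) (v d₁)
    obtain ⟨d₃, h₃⟩ := h.spanning (v (c₀ i)) (v d₁) (v d₂)
    have a₁ : v d₁ ≠ v (c₀ i) := fun e => h₁ (e ▸ Submodule.subset_span (by simp))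
    have a₂ : v d₂ ≠ v (c₀ i) := fun e => h₂ (e ▸ Submodule.subset_span (by simp))
    have a₃ : v d₃ ≠ v (c₀ i) := fun e => h₃ (e ▸ Submodule.subset_span (by simp))
    have a₂₁ : v d₂ ≠ v d₁ := fun e => h₂ (e ▸ Submodule.subset_span (by simp))
    have a₃₁ : v d₃ ≠ v d₁ := fun e => h₃ (e ▸ Submodule.subset_span (by simp))
    have a₃₂ : v d₃ ≠ v d₂ := fun e => h₃ (e ▸ Submodule.subset_span (by simp))
    have hole : ∀ d, v d ≠ v (c₀ i) → d ∉ Set.range c₀ := by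
      rintro d hd ⟨k, rfl⟩
      exact hd (h1 k i)
    have fin : ∀ d, v d ≠ v (c₀ i) → v d₃ ≠ v d → ¬ B (update c₀ i d) →
        ∃ c, R c ∧ (∃ i l, v (c i) ≠ v (c l)) ∧
          ∃ u ∉ Set.range c, ∃ u' ∉ Set.range c, v u ≠ v u' := by
      intro d hd hd₃ hB
      refine ⟨_, h.move c₀ i d hc₀ (hole d hd) (Ne.symm hd) hB, ⟨i, j, ?_⟩, d₃, ?_, c₀ i, ?_, a₃⟩
      · rw [update_self, update_of_ne hji, h1 j i]
        exact hd
      · rw [mem_range_update hinj]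
        rintro (e | ⟨e, -⟩)
        · exact hd₃ (by rw [e])
        · exact hole d₃ a₃ e
      · rw [mem_range_update hinj]
        rintro (e | ⟨-, e⟩)
        · exact hd (by rw [e])
        · exact e rfl
    by_cases hB : B (update c₀ i d₁)
    · refine fin d₂ a₂ a₃₂ fun hB' => a₂₁ ?_
      have := h.blocked_sub_eq hinj (hole d₁ a₁) (hole d₂ a₂) hB hB'
      exact (sub_left_inj.mp this).symm
    · exact fin d₁ a₁ a₃₁ hB

open Submodule in
/-- Two colors and two holes can be chosen so that the weight of one hole is independent of the
other three weights. -/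
theorem exists_independent (h : SlidingGame v f B R P M) {c : D → Ω}
    (h1 : ∃ i l, v (c i) ≠ v (c l))
    (h2 : ∃ u ∉ Set.range c, ∃ u' ∉ Set.range c, v u ≠ v u') :
    ∃ i l, ∃ u ∉ Set.range c, ∃ u' ∉ Set.range c, v (c i) ≠ v (c l) ∧ v u ≠ v (c i) ∧
      v u ≠ v (c l) ∧ v u' ∉ span ℚ {v (c i), v (c l), v u} := by
  set W := span ℚ (v '' (Set.range c)ᶜ) with hW
  have hole : ∀ u, u ∉ Set.range c → v u ∈ W := fun u hu => subset_span ⟨u, hu, rfl⟩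
  by_cases hex : ∃ i l, v (c i) ≠ v (c l) ∧ ∀ k, v (c k) ∈ W ⊔ span ℚ {v (c i), v (c l)}
  · obtain ⟨i, l, hil, hall⟩ := hex
    have step : ∀ q, ∃ u ∉ Set.range c, v u ∉ span ℚ {v (c i), v (c l), q} := by
      intro q
      by_contra! hno
      have hWle : W ≤ span ℚ {v (c i), v (c l), q} := by
        rw [hW, span_le]
        rintro _ ⟨u, hu, rfl⟩
        exact hno u hu
      have hle : W ⊔ span ℚ {v (c i), v (c l)} ≤ span ℚ {v (c i), v (c l), q} := by
        refine sup_le hWle (span_mono ?_)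
        intro t ht
        simp only [Set.mem_insert_iff, Set.mem_singleton_iff] at ht ⊢
        tauto
      obtain ⟨a, ha⟩ := h.spanning (v (c i)) (v (c l)) q
      apply ha
      by_cases har : a ∈ Set.range c
      · obtain ⟨k, rfl⟩ := har
        exact hle (hall k)
      · exact hno a har
    obtain ⟨u, hu, hus⟩ := step 0
    obtain ⟨u', hu', hus'⟩ := step (v u)
    exact ⟨i, l, u, hu, u', hu', hil, fun e => hus (e ▸ subset_span (by simp)),
      fun e => hus (e ▸ subset_span (by simp)), hus'⟩
  · push Not at hex
    have : ∃ i, v (c i) ∉ W := by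
      obtain ⟨i, l, hil⟩ := h1
      obtain ⟨k, hk⟩ := hex i l hil
      exact ⟨k, fun hkW => hk (mem_sup_left hkW)⟩
    obtain ⟨i, hi⟩ := this
    have : ∃ l, v (c l) ∉ W ⊔ span ℚ {v (c i)} := by
      by_contra! hno
      obtain ⟨l, hl⟩ : ∃ l, v (c i) ≠ v (c l) := by
        by_contra! hall
        obtain ⟨a, b, hab⟩ := h1
        exact hab ((hall a).symm.trans (hall b))
      obtain ⟨k, hk⟩ := hex i l hl
      exact hk ((sup_le_sup_left (span_mono (by simp)) W) (hno k))
    obtain ⟨l, hl⟩ := this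
    obtain ⟨u, hu, u', hu', huu⟩ := h2
    refine ⟨i, l, u, hu, u', hu', ?_, ?_, ?_, ?_⟩
    · intro e
      exact hl (mem_sup_right (e ▸ subset_span (by simp)))
    · intro e
      exact hi (e ▸ hole u hu)
    · intro e
      exact hl (mem_sup_left (e ▸ hole u hu))
    · intro hmem
      rw [mem_span_triple] at hmem
      obtain ⟨α, β, τ, e⟩ := hmem
      have hβ : β = 0 := by
        by_contra hβ
        apply hl
        have : v (c l) = β⁻¹ • (v u' - τ • v u) + (-(β⁻¹ * α)) • v (c i) := by
          rw [← e]
          have : β⁻¹ * β = 1 := inv_mul_cancel₀ hβ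
          match_scalars <;> simp [this]
        rw [this]
        exact add_mem (mem_sup_left (smul_mem _ _ (sub_mem (hole u' hu')
          (smul_mem _ _ (hole u hu))))) (mem_sup_right (smul_mem _ _ (subset_span (by simp))))
      have hα : α = 0 := by
        by_contra hα
        apply hi
        have : v (c i) = α⁻¹ • (v u' - τ • v u) := by
          rw [← e, hβ]
          have : α⁻¹ * α = 1 := inv_mul_cancel₀ hα
          match_scalars <;> simp [this]
        rw [this]
        exact smul_mem _ _ (sub_mem (hole u' hu') (smul_mem _ _ (hole u hu)))
      rw [hα, hβ, zero_smul, zero_smul, zero_add, zero_add] at e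
      have := congrArg f e
      rw [map_smul, h.aff, h.aff, smul_eq_mul, mul_one] at this
      rw [this, one_smul] at e
      exact huu e

/-- The heart of the game: an independent quadruple, one of whose moves is blocked, is impossible
once a position carrying the other color has a target. -/
theorem false_of_blocked (h : SlidingGame v f B R P M) (hD : ∀ i : D, ∃ j, j ≠ i)
    (hH : ∀ c : D → Ω, ∀ a, ∃ b, b ∉ Set.range c ∧ b ≠ a)
    (hM : ∀ i, P i → (M i).Nonempty) (hP : ∀ i l, i ≠ l → P i ∨ P l)
    {c : D → Ω} (hc : R c) {i l : D} {u u' : Ω} (hu : u ∉ Set.range c) (hu' : u' ∉ Set.range c)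
    (hil : v (c i) ≠ v (c l)) (hui : v u ≠ v (c i)) (hul : v u ≠ v (c l)) (huu : v u ≠ v u')
    (hu'i : v u' ≠ v (c i)) (hu'l : v u' ≠ v (c l))
    (h1 : v u' - v (c l) ≠ v u - v (c i))
    (h2 : v u' - v u + v (c i) ≠ v u)
    (hB : B (update c i u)) : False := by
  have hinj := h.inj c hc
  have hBi : ¬ B (update c i u') := fun hB' => huu <| by
    have := h.blocked_sub_eq hinj hu hu' hB hB'
    exact sub_left_inj.mp this
  have hBl : ¬ B (update c l u') := fun hB' => h1
    (h.blocked_sub_eq hinj hu hu' hB hB').symm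
  have hBlu : ¬ B (update c l u) := fun hB' => hil <| by
    have := h.blocked_sub_eq hinj hu hu hB hB'
    exact sub_right_inj.mp this
  have main : ∀ c', R c' → Set.range c' = Set.range c → ∀ i l, P l → v (c' i) ≠ v (c' l) →
      v u ≠ v (c' i) → v u ≠ v (c' l) → v u' ≠ v (c' i) → v u' ≠ v (c' l) →
      v u' - v (c' l) ≠ v u - v (c' i) → v u' - v u + v (c' i) ≠ v u →
      B (update c' i u) → ¬ B (update c' i u') → ¬ B (update c' l u') → ¬ B (update c' l u) →
      False := by
    intro c' hc' hr i l hl hil hui hul hu'i hu'l h1 h2 hB hBi hBl hBlu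
    have hinj' := h.inj c' hc'
    rw [← hr] at hu hu'
    obtain ⟨γ, hγ⟩ := hM l hl
    obtain ⟨j, rfl, hj⟩ := h.blocked_of_target hD hH hc' hl hu' (Ne.symm hu'l) (Ne.symm hu'i)
      (Ne.symm hil) hBl hBi hγ
    have e := h.blocked_sub_eq hinj' hu hu' hB hj
    have ej : v (c' j) = v u' - v u + v (c' i) := by
      rw [sub_eq_sub_iff_add_eq_add] at e
      have : v (c' j) = (v u + v (c' j)) - v u := by abel
      rw [this, e]; abel
    have hBj : ¬ B (update c' j u) := fun hB' => by
      have := h.blocked_sub_eq hinj' hu hu hB hB'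
      rw [sub_right_inj, ej] at this
      apply huu
      have e2 : v u' - v u = 0 := by
        have e3 : v u' - v u = (v u' - v u + v (c' i)) - v (c' i) := by abel
        rw [e3, ← this, sub_self]
      exact (sub_eq_zero.mp e2).symm
    obtain ⟨k, hk, hkB⟩ := h.blocked_of_target hD hH hc' hl (l := j) hu (Ne.symm hul)
      (by rw [ej]; exact h2) (by
        rw [ej]
        intro e2
        apply h1
        rw [e2]; abel) hBlu hBj hγ
    rw [hinj' hk] at hkB
    exact hBj hkB
  have hne : i ≠ l := fun e => hil (by rw [e])
  rcases hP i l hne with hi | hl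
  · obtain ⟨c', hc', hr, ei, el⟩ := h.exchange hc hu' (Ne.symm hu'i) (Ne.symm hu'l) hil hBi hBl
    have hinj' := h.inj c' hc'
    have rg : ∀ (j k : D) (a : Ω), c' j = c k → (B (update c' j a) ↔ B (update c k a)) := by
      intro j k a e
      have : Set.range (update c' j a) = Set.range (update c k a) := by
        ext t
        rw [mem_range_update hinj', mem_range_update hinj, hr, e]
      exact ⟨h.range_congr _ _ this, h.range_congr _ _ this.symm⟩
    refine main c' hc' hr l i hi ?_ ?_ ?_ ?_ ?_ ?_ ?_ ?_ ?_ ?_ ?_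
    all_goals first
      | rw [rg _ _ _ el]; assumption
      | rw [rg _ _ _ ei]; assumption
      | (simp only [ei, el]; assumption)
  · exact main c hc rfl i l hl hil hui hul hu'i hu'l h1 h2 hB hBi hBl hBlu

open Submodule in
/-- A sliding game with at least two positions, in which at most one position has no target, has no
reachable state. -/
theorem false_of_reachable (h : SlidingGame v f B R P M) (hD : ∀ i : D, ∃ j, j ≠ i) [Nonempty D]
    (hH : ∀ c : D → Ω, ∀ a, ∃ b, b ∉ Set.range c ∧ b ≠ a)
    (hM : ∀ i, P i → (M i).Nonempty) (hP : ∀ i l, i ≠ l → P i ∨ P l)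
    {c₀ : D → Ω} (hc₀ : R c₀) : False := by
  obtain ⟨c, hc, h1, h2⟩ := h.exists_two_weights hD hH hc₀
  obtain ⟨i, l, u, hu, u', hu', hil, hui, hul, hns⟩ := h.exists_independent h1 h2
  have hinj := h.inj c hc
  have comb : ∀ p q r : ℚ, v u' ≠ p • v (c i) + q • v (c l) + r • v u := by
    intro p q r e
    exact hns (e ▸ mem_span_triple.mpr ⟨p, q, r, rfl⟩)
  have huu : v u ≠ v u' := fun e => comb 0 0 1 (by rw [← e]; module)
  have hu'i : v u' ≠ v (c i) := fun e => comb 1 0 0 (by rw [e]; module)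
  have hu'l : v u' ≠ v (c l) := fun e => comb 0 1 0 (by rw [e]; module)
  have fin := fun {i l : D} {u u' : Ω} => h.false_of_blocked hD hH hM hP hc (i := i) (l := l)
    (u := u) (u' := u')
  have n1 : ¬ B (update c i u) := fin hu hu' hil hui hul huu hu'i hu'l
    (fun e => comb (-1) 1 1 (by
      rw [sub_eq_iff_eq_add] at e
      rw [e]; module))
    (fun e => comb (-1) 0 2 (by
      have : v u' = v u' - v u + v (c i) + (v u - v (c i)) := by abel
      rw [this, e]; module))
  have n2 : ¬ B (update c l u) := fin hu hu' (Ne.symm hil) hul hui huu hu'l hu'i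
    (fun e => comb 1 (-1) 1 (by
      rw [sub_eq_iff_eq_add] at e
      rw [e]; module))
    (fun e => comb 0 (-1) 2 (by
      have : v u' = v u' - v u + v (c l) + (v u - v (c l)) := by abel
      rw [this, e]; module))
  have n3 : ¬ B (update c i u') := fin hu' hu hil hu'i hu'l (Ne.symm huu) hui hul
    (fun e => comb 1 (-1) 1 (by
      rw [sub_eq_sub_iff_add_eq_add] at e
      have : v u' = v u' + v (c l) - v (c l) := by abel
      rw [this, ← e]; module))
    (fun e => comb (1/2) 0 (1/2) (by
      have : v u' = (1/2 : ℚ) • (v u' + v u') := by module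
      rw [this]
      nth_rewrite 1 [← e]
      module))
  have n4 : ¬ B (update c l u') := fin hu' hu (Ne.symm hil) hu'l hu'i (Ne.symm huu) hul hui
    (fun e => comb (-1) 1 1 (by
      rw [sub_eq_sub_iff_add_eq_add] at e
      have : v u' = v u' + v (c i) - v (c i) := by abel
      rw [this, ← e]; module))
    (fun e => comb 0 (1/2) (1/2) (by
      have : v u' = (1/2 : ℚ) • (v u' + v u') := by module
      rw [this]
      nth_rewrite 1 [← e]
      module))
  have main : ∀ i l, P i → v (c i) ≠ v (c l) → v u ≠ v (c i) → v u ≠ v (c l) →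
      v u' ≠ v (c i) → v u' ≠ v (c l) → ¬ B (update c i u) → ¬ B (update c l u) →
      ¬ B (update c i u') → ¬ B (update c l u') → False := by
    intro i l hi hil hui hul hu'i hu'l n1 n2 n3 n4
    obtain ⟨γ, hγ⟩ := hM i hi
    obtain ⟨j, hj, hjB⟩ := h.blocked_of_target hD hH hc hi hu (Ne.symm hui) (Ne.symm hul) hil
      n1 n2 hγ
    obtain ⟨k, hk, hkB⟩ := h.blocked_of_target hD hH hc hi hu' (Ne.symm hu'i) (Ne.symm hu'l) hil
      n3 n4 hγ
    have e := h.blocked_sub_eq hinj hu hu' hjB hkB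
    rw [hj, hk] at e
    exact huu (sub_left_inj.mp e)
  rcases hP i l (fun e => hil (by rw [e])) with hi | hl
  · exact main i l hi hil hui hul hu'i hu'l n1 n2 n3 n4
  · exact main l i hl (Ne.symm hil) hul hui hu'l hu'i n2 n1 n4 n3

end SlidingGame

/-- A family of at most `|Ω| - 3` finite subsets of `Ω` admits a weighting of `Ω` in a vector space,
of affine type and not spanned by three vectors, for which subsets in the family with the same
cardinality have the same total weight. -/
theorem exists_weights {Ω : Type} [Fintype Ω] [DecidableEq Ω] (𝓕 : Finset (Finset Ω))
    (h : 𝓕.card + 3 ≤ Fintype.card Ω) (h4 : 4 ≤ Fintype.card Ω) :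
    ∃ (Q : Type) (_ : AddCommGroup Q) (_ : Module ℚ Q) (v : Ω → Q) (f : Q →ₗ[ℚ] ℚ),
      (∀ a, f (v a) = 1) ∧
      (∀ q₁ q₂ q₃, ∃ a, v a ∉ Submodule.span ℚ {q₁, q₂, q₃}) ∧
      ∀ A ∈ 𝓕, ∀ A' ∈ 𝓕, A.card = A'.card → ∑ a ∈ A, v a = ∑ a ∈ A', v a := by
  let χ : Finset Ω → Ω → ℚ := fun A => ∑ a ∈ A, Pi.single a 1
  let W : Submodule ℚ (Ω → ℚ) := Submodule.span ℚ
    {w | ∃ A ∈ 𝓕, ∃ A' ∈ 𝓕, A.card = A'.card ∧ w = χ A - χ A'}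
  let g : (Ω → ℚ) →ₗ[ℚ] ℚ := Fintype.linearCombination ℚ (fun _ : Ω => (1 : ℚ))
  have hg1 : ∀ a, g (Pi.single a 1) = 1 := by
    intro a
    simp [g, Fintype.linearCombination_apply_single]
  have hg : W ≤ LinearMap.ker g := by
    rw [Submodule.span_le]
    rintro _ ⟨A, -, A', -, e, rfl⟩
    simp only [SetLike.mem_coe, LinearMap.mem_ker, map_sub, χ, map_sum, hg1]
    simp [e]
  have hdim : Module.finrank ℚ W + 4 ≤ Fintype.card Ω := by
    rcases 𝓕.eq_empty_or_nonempty with rfl | ⟨A₀, hA₀⟩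
    · have : W = ⊥ := by simp [W]
      rw [this, finrank_bot]
      omega
    · let T : Finset (Ω → ℚ) := (𝓕.erase A₀).image fun A => χ A - χ A₀
      have hW : W ≤ Submodule.span ℚ (T : Set (Ω → ℚ)) := by
        have key : ∀ A ∈ 𝓕, χ A - χ A₀ ∈ Submodule.span ℚ (T : Set (Ω → ℚ)) := by
          intro A hA
          by_cases e : A = A₀
          · rw [e, sub_self]
            exact zero_mem _
          · exact Submodule.subset_span (Finset.mem_coe.mpr
              (Finset.mem_image_of_mem _ (Finset.mem_erase.mpr ⟨e, hA⟩)))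
        rw [Submodule.span_le]
        rintro _ ⟨A, hA, A', hA', -, rfl⟩
        rw [← sub_sub_sub_cancel_right _ _ (χ A₀)]
        exact sub_mem (key A hA) (key A' hA')
      have h1 := Submodule.finrank_mono hW
      have h2 := finrank_span_finset_le_card (R := ℚ) T
      have h3 : T.card ≤ (𝓕.erase A₀).card := Finset.card_image_le
      have h5 := Finset.card_erase_add_one hA₀
      rw [Set.finrank] at h2
      omega
  refine ⟨(Ω → ℚ) ⧸ W, inferInstance, inferInstance, fun a => W.mkQ (Pi.single a 1),
    W.liftQ g hg, fun a => ?_, fun q₁ q₂ q₃ => ?_, fun A hA A' hA' e => ?_⟩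
  · simpa using hg1 a
  · by_contra! hno
    have hr : LinearMap.range W.mkQ ≤ Submodule.span ℚ {q₁, q₂, q₃} := by
      rintro _ ⟨w, rfl⟩
      rw [pi_eq_sum_univ' w, map_sum]
      refine sum_mem fun a _ => ?_
      rw [map_smul]
      refine Submodule.smul_mem _ _ ?_
      convert hno a using 3
    rw [Submodule.range_mkQ, top_le_iff] at hr
    classical
    have h1 := finrank_span_finset_le_card (R := ℚ) ({q₁, q₂, q₃} : Finset ((Ω → ℚ) ⧸ W))
    have h2 : ({q₁, q₂, q₃} : Finset ((Ω → ℚ) ⧸ W)).card ≤ 3 := Finset.card_le_three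
    have h0 : Submodule.span ℚ
        ((({q₁, q₂, q₃} : Finset ((Ω → ℚ) ⧸ W)) : Set ((Ω → ℚ) ⧸ W))) = ⊤ := by simpa using hr
    rw [Set.finrank, h0, finrank_top] at h1
    have h3 := Submodule.finrank_quotient_add_finrank W
    rw [Module.finrank_fintype_fun_eq_card] at h3
    omega
  · rw [← map_sum, ← map_sum, ← sub_eq_zero, ← map_sub, Submodule.mkQ_apply,
      Submodule.Quotient.mk_eq_zero]
    exact Submodule.subset_span ⟨A, hA, A', hA', e, rfl⟩

namespace SimpleGraph

variable {V Ω : Type*} {G : SimpleGraph V}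

/-- A coloring of pairs is proper on `G` if edges of `G` with a common end get different colors. -/
def IsProperEdgeColoring (G : SimpleGraph V) (φ : Sym2 V → Ω) : Prop :=
  ∀ u v w, G.Adj u v → G.Adj u w → φ s(u, v) = φ s(u, w) → v = w

/-- The set of colors on the edges of `G` incident with a vertex. -/
def incidentColors (G : SimpleGraph V) [Fintype V] [DecidableRel G.Adj] [DecidableEq Ω]
    (φ : Sym2 V → Ω) (u : V) : Finset Ω :=
  (G.neighborFinset u).image fun v => φ s(u, v)

section

variable [Fintype V] [DecidableRel G.Adj] [DecidableEq Ω]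

theorem mem_incidentColors {φ : Sym2 V → Ω} {u : V} {a : Ω} :
    a ∈ G.incidentColors φ u ↔ ∃ v, G.Adj u v ∧ φ s(u, v) = a := by
  simp [incidentColors]

theorem IsProperEdgeColoring.card_incidentColors {φ : Sym2 V → Ω}
    (h : G.IsProperEdgeColoring φ) (u : V) : (G.incidentColors φ u).card = G.degree u := by
  rw [incidentColors, Finset.card_image_of_injOn, card_neighborFinset_eq_degree]
  intro v hv w hw e
  exact h u v w (by simpa using hv) (by simpa using hw) e

/-- In a component of the subgraph of edges colored `a` or `b`, at most two vertices see exactly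
one of the two colors. -/
theorem IsProperEdgeColoring.false_of_three_odd {φ : Sym2 V → Ω} (h : G.IsProperEdgeColoring φ)
    {a b : Ω} {H : SimpleGraph V}
    (hH : ∀ u v, H.Adj u v → G.Adj u v ∧ (φ s(u, v) = a ∨ φ s(u, v) = b))
    {x p q r : V} (hp : H.Reachable x p) (hq : H.Reachable x q) (hr : H.Reachable x r)
    (hpq : p ≠ q) (hpr : p ≠ r) (hqr : q ≠ r)
    (op : ¬ (a ∈ G.incidentColors φ p ↔ b ∈ G.incidentColors φ p))
    (oq : ¬ (a ∈ G.incidentColors φ q ↔ b ∈ G.incidentColors φ q))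
    (or : ¬ (a ∈ G.incidentColors φ r ↔ b ∈ G.incidentColors φ r)) : False := by
  classical
  let C := H.connectedComponentMk x
  have hC := C.connected_toSimpleGraph
  have h1 := hC.card_vert_le_card_edgeSet_add_one
  have h2 := C.toSimpleGraph.sum_degrees_eq_twice_card_edges
  have hdeg : ∀ w : C, C.toSimpleGraph.degree w ≤ (G.incidentColors φ w ∩ {a, b}).card := by
    intro w
    rw [← card_neighborFinset_eq_degree]
    refine Finset.card_le_card_of_injOn (fun z => φ s(w.1, z.1)) ?_ ?_
    · intro z hz
      have hz' : H.Adj w z :=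
        (by simpa using hz : C.toSimpleGraph.Adj w z)
      obtain ⟨h1, h2⟩ := hH _ _ hz'
      simp only [Finset.coe_inter, Set.mem_inter_iff, Finset.mem_coe, Finset.mem_insert,
        Finset.mem_singleton]
      exact ⟨mem_incidentColors.mpr ⟨_, h1, rfl⟩, h2⟩
    · intro z hz z' hz' e
      have k1 : H.Adj w z :=
        (by simpa using hz : C.toSimpleGraph.Adj w z)
      have k2 : H.Adj w z' :=
        (by simpa using hz' : C.toSimpleGraph.Adj w z')
      exact Subtype.ext (h _ _ _ (hH _ _ k1).1 (hH _ _ k2).1 e)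
  have hdeg2 : ∀ w : C, C.toSimpleGraph.degree w ≤ 2 := fun w =>
    (hdeg w).trans ((Finset.card_le_card Finset.inter_subset_right).trans Finset.card_le_two)
  have hdeg1 : ∀ w : C, ¬ (a ∈ G.incidentColors φ w ↔ b ∈ G.incidentColors φ w) →
      C.toSimpleGraph.degree w ≤ 1 := by
    intro w hw
    refine (hdeg w).trans ?_
    rw [Finset.card_le_one]
    intro s hs t ht
    simp only [Finset.mem_inter, Finset.mem_insert, Finset.mem_singleton] at hs ht
    grind
  have mem : ∀ w, H.Reachable x w → w ∈ C := by
    intro w hw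
    exact ConnectedComponent.sound hw.symm
  let T : Finset C := {⟨p, mem p hp⟩, ⟨q, mem q hq⟩, ⟨r, mem r hr⟩}
  have hT : T.card = 3 := Finset.card_eq_three.mpr ⟨_, _, _, by simpa using hpq,
    by simpa using hpr, by simpa using hqr, rfl⟩
  have hsum : ∑ w : C, (C.toSimpleGraph.degree w + if w ∈ T then 1 else 0) ≤ ∑ w : C, 2 := by
    refine Finset.sum_le_sum fun w _ => ?_
    split_ifs with hw
    · have : ¬ (a ∈ G.incidentColors φ w ↔ b ∈ G.incidentColors φ w) := by
        simp only [T, Finset.mem_insert, Finset.mem_singleton] at hw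
        rcases hw with rfl | rfl | rfl <;> assumption
      have := hdeg1 w this
      omega
    · exact hdeg2 w
  rw [Finset.sum_add_distrib, h2, Finset.sum_boole, Finset.filter_mem_eq_inter,
    Finset.univ_inter, hT] at hsum
  simp only [Finset.sum_const, Finset.card_univ, smul_eq_mul, Nat.cast_ofNat] at hsum
  rw [Nat.card_eq_fintype_card, Nat.card_eq_fintype_card, ← edgeFinset_card] at h1
  omega

/-- The Kempe change at `x` for the colors `a` and `b`. -/
theorem IsProperEdgeColoring.exists_kempe {φ : Sym2 V → Ω} (h : G.IsProperEdgeColoring φ)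
    (a b : Ω) (x : V) :
    ∃ (φ' : Sym2 V → Ω) (K : Set V), G.IsProperEdgeColoring φ' ∧ x ∈ K ∧
      (∀ u ∈ K, ∀ v, G.Adj u v → φ' s(u, v) = Equiv.swap a b (φ s(u, v))) ∧
      (∀ u ∉ K, ∀ v, G.Adj u v → φ' s(u, v) = φ s(u, v)) ∧
      (∀ u ∈ K, ∀ v, G.Adj u v → φ s(u, v) = a ∨ φ s(u, v) = b → v ∈ K) ∧
      ∀ p ∈ K, ∀ q ∈ K, ∀ r ∈ K, p ≠ q → p ≠ r → q ≠ r →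
        ¬ (a ∈ G.incidentColors φ p ↔ b ∈ G.incidentColors φ p) →
        ¬ (a ∈ G.incidentColors φ q ↔ b ∈ G.incidentColors φ q) →
        ¬ (a ∈ G.incidentColors φ r ↔ b ∈ G.incidentColors φ r) → False := by
  classical
  let H : SimpleGraph V :=
    { Adj := fun u v => G.Adj u v ∧ (φ s(u, v) = a ∨ φ s(u, v) = b)
      symm := ⟨fun u v huv => ⟨huv.1.symm, by rw [Sym2.eq_swap]; exact huv.2⟩⟩
      loopless := ⟨fun u hu => G.loopless.irrefl u hu.1⟩ }
  let K : Set V := {w | H.Reachable x w}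
  have closed : ∀ u ∈ K, ∀ v, G.Adj u v → φ s(u, v) = a ∨ φ s(u, v) = b → v ∈ K := by
    intro u hu v huv hc
    have : H.Adj u v := ⟨huv, hc⟩
    exact Reachable.trans hu this.reachable
  let φ' : Sym2 V → Ω := fun e => if ∀ u ∈ e, u ∈ K then Equiv.swap a b (φ e) else φ e
  have inside : ∀ u ∈ K, ∀ v, G.Adj u v → φ' s(u, v) = Equiv.swap a b (φ s(u, v)) := by
    intro u hu v huv
    simp only [φ', Sym2.mem_iff, forall_eq_or_imp, forall_eq]
    split_ifs with hc
    · rfl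
    · have hv : v ∉ K := fun hv => hc ⟨hu, hv⟩
      rw [Equiv.swap_apply_of_ne_of_ne]
      · exact fun e => hv (closed u hu v huv (.inl e))
      · exact fun e => hv (closed u hu v huv (.inr e))
  have outside : ∀ u ∉ K, ∀ v, G.Adj u v → φ' s(u, v) = φ s(u, v) := by
    intro u hu v huv
    simp only [φ', Sym2.mem_iff, forall_eq_or_imp, forall_eq]
    rw [if_neg (fun hc => hu hc.1)]
  refine ⟨φ', K, ?_, Reachable.refl x, inside, outside, closed, ?_⟩
  · intro u v w huv huw e
    by_cases hu : u ∈ K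
    · rw [inside u hu v huv, inside u hu w huw] at e
      exact h u v w huv huw ((Equiv.swap a b).injective e)
    · rw [outside u hu v huv, outside u hu w huw] at e
      exact h u v w huv huw e
  · intro p hp q hq r hr hpq hpr hqr op oq or
    exact h.false_of_three_odd (H := H) (fun _ _ huv => huv) hp hq hr hpq hpr hqr op oq or

end

end SimpleGraph

namespace SlidingGame

open Function

/-- In a game with a single position, moving to a target is always blocked. -/
theorem blocked_of_subsingleton {D Ω Q : Type*} [Fintype D] [DecidableEq D] [AddCommGroup Q]
    [Module ℚ Q] {v : Ω → Q} {f : Q →ₗ[ℚ] ℚ} {B R : (D → Ω) → Prop} {P : D → Prop}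
    {M : D → Set Ω} [Subsingleton D] (h : SlidingGame v f B R P M) {c : D → Ω} (hc : R c) {i : D}
    (hi : P i) {γ : Ω} (hγ : γ ∈ M i) : B (update c i γ) := by
  have hole : ∀ (c : D → Ω) (d : Ω), d ≠ c i → d ∉ Set.range c := by
    rintro c d hd ⟨k, rfl⟩
    exact hd (by rw [Subsingleton.elim k i])
  by_cases hv : v (c i) = v γ
  · obtain ⟨d₁, h₁⟩ := h.spanning (v (c i)) (v (c i)) (v (c i))
    obtain ⟨d₂, h₂⟩ := h.spanning (v (c i)) (v d₁) (v d₁)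
    have a₁ : v d₁ ≠ v (c i) := fun e => h₁ (e ▸ Submodule.subset_span (by simp))
    have a₂ : v d₂ ≠ v (c i) := fun e => h₂ (e ▸ Submodule.subset_span (by simp))
    have a₂₁ : v d₂ ≠ v d₁ := fun e => h₂ (e ▸ Submodule.subset_span (by simp))
    have n₁ : d₁ ∉ Set.range c := hole c _ fun e => a₁ (by rw [e])
    have n₂ : d₂ ∉ Set.range c := hole c _ fun e => a₂ (by rw [e])
    have fin : ∀ d, v d ≠ v (c i) → d ∉ Set.range c → ¬ B (update c i d) → B (update c i γ) := by
      intro d hd hdc hB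
      have := h.no_win _ i γ (h.move c i d hc hdc (Ne.symm hd) hB) hi hγ
        (hole _ _ (by rw [update_self]; rintro rfl; exact hd hv.symm))
        (by rw [update_self, ← hv]; exact hd)
      rwa [update_idem] at this
    by_cases hB : B (update c i d₁)
    · exact fin d₂ a₂ n₂ fun hB' =>
        a₂₁ (sub_left_inj.mp (h.blocked_sub_eq (h.inj c hc) n₂ n₁ hB' hB))
    · exact fin d₁ a₁ n₁ hB
  · exact h.no_win c i γ hc hi hγ (hole c _ fun e => hv (by rw [e])) hv

end SlidingGame

theorem Function.update_eq_swap_comp {D Ω : Type*} [DecidableEq D] [DecidableEq Ω] {c : D → Ω}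
    (hc : Function.Injective c) (i : D) {b : Ω} (hb : b ∉ Set.range c) :
    Function.update c i b = Equiv.swap (c i) b ∘ c := by
  ext k
  by_cases hk : k = i
  · subst hk; simp
  · rw [Function.update_of_ne hk, Function.comp_apply, Equiv.swap_apply_of_ne_of_ne]
    · exact fun e => hk (hc e)
    · exact fun e => hb ⟨k, e⟩

theorem Finset.image_swap_of_iff {Ω : Type*} [DecidableEq Ω] {A : Finset Ω} {a b : Ω}
    (h : a ∈ A ↔ b ∈ A) : A.image (Equiv.swap a b) = A := by
  refine Finset.eq_of_subset_of_card_le ?_ ?_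
  · intro t ht
    obtain ⟨s, hs, rfl⟩ := Finset.mem_image.mp ht
    rw [Equiv.swap_apply_def]
    split_ifs with h1 h2
    · exact h.mp (h1 ▸ hs)
    · exact h.mpr (h2 ▸ hs)
    · exact hs
  · rw [Finset.card_image_of_injective _ (Equiv.injective _)]

theorem Finset.image_swap_image_swap {Ω : Type*} [DecidableEq Ω] (A : Finset Ω) (a b : Ω) :
    (A.image (Equiv.swap a b)).image (Equiv.swap a b) = A := by
  rw [Finset.image_image]
  have : Equiv.swap a b ∘ Equiv.swap a b = id := funext fun t => by simp
  rw [this, Finset.image_id]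

/-- Swapping two colors of different weights, exactly one of which is present, changes the
weight. -/
theorem Finset.sum_image_swap_ne {Ω Q : Type*} [DecidableEq Ω] [AddCommGroup Q] {v : Ω → Q}
    {a b : Ω} (hv : v a ≠ v b) {A : Finset Ω} (h : ¬ (a ∈ A ↔ b ∈ A)) :
    ∑ t ∈ A.image (Equiv.swap a b), v t ≠ ∑ t ∈ A, v t := by
  have key : ∀ a b : Ω, v a ≠ v b → a ∈ A → b ∉ A →
      ∑ t ∈ A.image (Equiv.swap a b), v t ≠ ∑ t ∈ A, v t := by
    intro a b hv ha hb
    rw [Finset.sum_image (Equiv.injective _).injOn, ← Finset.add_sum_erase _ _ ha,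
      ← Finset.add_sum_erase A v ha, Equiv.swap_apply_left,
      Finset.sum_congr rfl (g := fun t => v t)]
    · exact fun e => hv (add_right_cancel e).symm
    · intro t ht
      rw [Equiv.swap_apply_of_ne_of_ne (Finset.ne_of_mem_erase ht)]
      rintro rfl
      exact hb (Finset.mem_of_mem_erase ht)
  by_cases ha : a ∈ A
  · exact key a b hv ha fun hb => h ⟨fun _ => hb, fun _ => ha⟩
  · rw [Equiv.swap_comm]
    exact key b a hv.symm (by tauto) ha

namespace SimpleGraph

variable {V Ω : Type*} {G : SimpleGraph V} [Fintype V] [DecidableRel G.Adj] [DecidableEq Ω]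

/-- The Kempe change applied to a coloring that distinguishes all vertices under consideration
except for `x` and `y`, when no coloring distinguishes all of them. -/
theorem IsProperEdgeColoring.exists_recoloring {φ : Sym2 V → Ω} (h : G.IsProperEdgeColoring φ)
    {F : Set V} {x y : V} (hxy : x ≠ y)
    (hS : G.incidentColors φ x = G.incidentColors φ y)
    (hSF : ∀ w ∈ F, G.incidentColors φ w ≠ G.incidentColors φ x)
    (hinj : Set.InjOn (G.incidentColors φ) F)
    {a b : Ω} (ha : a ∈ G.incidentColors φ x) (hb : b ∉ G.incidentColors φ x)
    (hswap : ∀ w ∈ F, ∀ w' ∈ F, ¬ (a ∈ G.incidentColors φ w ↔ b ∈ G.incidentColors φ w) →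
      G.incidentColors φ w' ≠ (G.incidentColors φ w).image (Equiv.swap a b))
    (hnew : ∀ w ∈ F, G.incidentColors φ w ≠ (G.incidentColors φ x).image (Equiv.swap a b))
    (hstuck : ∀ φ' : Sym2 V → Ω, G.IsProperEdgeColoring φ' →
      ¬ Set.InjOn (G.incidentColors φ') (insert x (insert y F))) :
    ∃ φ' : Sym2 V → Ω, G.IsProperEdgeColoring φ' ∧
      (∀ w, w ≠ x → w ≠ y → G.incidentColors φ' w = G.incidentColors φ w) ∧
      G.incidentColors φ' x = (G.incidentColors φ x).image (Equiv.swap a b) ∧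
      G.incidentColors φ' y = (G.incidentColors φ x).image (Equiv.swap a b) ∧
      (∀ v, G.Adj x v → φ' s(x, v) = Equiv.swap a b (φ s(x, v))) ∧
      ∀ v, G.Adj x v → φ s(x, v) = a → v ≠ y →
        (a ∈ G.incidentColors φ v ↔ b ∈ G.incidentColors φ v) := by
  obtain ⟨φ', K, hφ', hxK, hin, hout, hcl, hodd⟩ := h.exists_kempe a b x
  have ox : ¬ (a ∈ G.incidentColors φ x ↔ b ∈ G.incidentColors φ x) := fun e => hb (e.mp ha)
  have csin : ∀ w ∈ K, G.incidentColors φ' w =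
      (G.incidentColors φ w).image (Equiv.swap a b) := by
    intro w hw
    rw [incidentColors, incidentColors, Finset.image_image]
    exact Finset.image_congr fun v hv => hin w hw v (by simpa using hv)
  have csout : ∀ w ∉ K, G.incidentColors φ' w = G.incidentColors φ w := by
    intro w hw
    rw [incidentColors, incidentColors]
    exact Finset.image_congr fun v hv => hout w hw v (by simpa using hv)
  have hyK : y ∈ K := by
    by_contra hyK
    have alt : ∀ w, G.incidentColors φ' w = G.incidentColors φ w ∨
        G.incidentColors φ' w = (G.incidentColors φ w).image (Equiv.swap a b) ∧
        ¬ (a ∈ G.incidentColors φ w ↔ b ∈ G.incidentColors φ w) := by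
      intro w
      by_cases hw : w ∈ K
      · by_cases ow : a ∈ G.incidentColors φ w ↔ b ∈ G.incidentColors φ w
        · left
          rw [csin w hw, Finset.image_swap_of_iff ow]
        · exact .inr ⟨csin w hw, ow⟩
      · exact .inl (csout w hw)
    have imginj : ∀ A A' : Finset Ω, A.image (Equiv.swap a b) = A'.image (Equiv.swap a b) →
        A = A' := by
      intro A A' e
      rw [← A.image_swap_image_swap a b, e, A'.image_swap_image_swap]
    have cx := csin x hxK
    have cy := csout y hyK
    have xy : G.incidentColors φ' x ≠ G.incidentColors φ' y := by
      rw [cx, cy, ← hS]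
      intro e
      exact hb (e ▸ Finset.mem_image.mpr ⟨a, ha, by simp⟩)
    have xw : ∀ w ∈ F, G.incidentColors φ' x ≠ G.incidentColors φ' w := by
      intro w hw e
      rw [cx] at e
      rcases alt w with e' | ⟨e', -⟩
      · exact hnew w hw (e'.symm.trans e.symm)
      · exact hSF w hw (imginj _ _ (e'.symm.trans e.symm))
    have yw : ∀ w ∈ F, G.incidentColors φ' y ≠ G.incidentColors φ' w := by
      intro w hw e
      rw [cy, ← hS] at e
      rcases alt w with e' | ⟨e', -⟩
      · exact hSF w hw (e'.symm.trans e.symm)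
      · apply hnew w hw
        rw [e, e', Finset.image_swap_image_swap]
    have ww : ∀ w ∈ F, ∀ w' ∈ F, G.incidentColors φ' w = G.incidentColors φ' w' → w = w' := by
      intro w hw w' hw' e
      rcases alt w with e1 | ⟨e1, o1⟩ <;> rcases alt w' with e2 | ⟨e2, o2⟩ <;> rw [e1, e2] at e
      · exact hinj hw hw' e
      · exact absurd e (hswap w' hw' w hw o2)
      · exact absurd e.symm (hswap w hw w' hw' o1)
      · exact hinj hw hw' (imginj _ _ e)
    refine hstuck φ' hφ' ?_
    rintro p (rfl | rfl | hp) q (rfl | rfl | hq) e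
    · rfl
    · exact absurd e xy
    · exact absurd e (xw q hq)
    · exact absurd e.symm xy
    · rfl
    · exact absurd e (yw q hq)
    · exact absurd e.symm (xw p hp)
    · exact absurd e.symm (yw p hp)
    · exact ww p hp q hq e
  have oy : ¬ (a ∈ G.incidentColors φ y ↔ b ∈ G.incidentColors φ y) := hS ▸ ox
  have even : ∀ w ∈ K, w ≠ x → w ≠ y →
      (a ∈ G.incidentColors φ w ↔ b ∈ G.incidentColors φ w) := by
    intro w hw hwx hwy
    by_contra ow
    exact hodd x hxK y hyK w hw hxy hwx.symm hwy.symm ox oy ow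
  refine ⟨φ', hφ', fun w hwx hwy => ?_, csin x hxK, ?_, hin x hxK, fun v hv e hvy => ?_⟩
  · by_cases hw : w ∈ K
    · rw [csin w hw, Finset.image_swap_of_iff (even w hw hwx hwy)]
    · exact csout w hw
  · rw [csin y hyK, hS]
  · exact even v (hcl x hxK v hv (.inl e)) hv.ne' hvy

open Function in
/-- The game played by the Kempe changes at `x`, when no proper coloring distinguishes all
vertices in `F` and in addition `x` and `y`. -/
theorem IsProperEdgeColoring.slidingGame [DecidableEq V] {Q : Type*} [AddCommGroup Q] [Module ℚ Q]
    {φ₀ : Sym2 V → Ω} {F : Finset V} {x y : V} (hxy : x ≠ y) (hxF : x ∉ F) (hyF : y ∉ F)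
    (hinj : Set.InjOn (G.incidentColors φ₀) F)
    (hstuck : ∀ φ : Sym2 V → Ω, G.IsProperEdgeColoring φ →
      ¬ Set.InjOn (G.incidentColors φ) (insert x (insert y F)))
    {v : Ω → Q} {f : Q →ₗ[ℚ] ℚ} (hf : ∀ a, f (v a) = 1)
    (hspan : ∀ q₁ q₂ q₃, ∃ a, v a ∉ Submodule.span ℚ {q₁, q₂, q₃})
    (hsum : ∀ A ∈ F.image (G.incidentColors φ₀), ∀ A' ∈ F.image (G.incidentColors φ₀),
      A.card = A'.card → ∑ a ∈ A, v a = ∑ a ∈ A', v a) :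
    SlidingGame (D := G.neighborSet x) v f
      (fun c => Finset.univ.image c ∈ F.image (G.incidentColors φ₀))
      (fun c => ∃ φ : Sym2 V → Ω, G.IsProperEdgeColoring φ ∧
        (∀ w, w ≠ x → w ≠ y → G.incidentColors φ w = G.incidentColors φ₀ w) ∧
        G.incidentColors φ x = G.incidentColors φ y ∧
        G.incidentColors φ x ∉ F.image (G.incidentColors φ₀) ∧
        c = fun i : G.neighborSet x => φ s(x, i.1))
      (fun i => i.1 ≠ y) (fun i => {γ | γ ∉ G.incidentColors φ₀ i}) := by
  have him : ∀ φ : Sym2 V → Ω, Finset.univ.image (fun i : G.neighborSet x => φ s(x, i)) =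
      G.incidentColors φ x := by
    intro φ
    ext t
    simp [mem_incidentColors]
  have injc : ∀ φ : Sym2 V → Ω, G.IsProperEdgeColoring φ →
      Injective (fun i : G.neighborSet x => φ s(x, i)) :=
    fun φ hφ i j e => Subtype.ext (hφ x i j i.2 j.2 e)
  have hF : ∀ w ∈ F, w ≠ x ∧ w ≠ y := fun w hw =>
    ⟨fun e => hxF (e ▸ hw), fun e => hyF (e ▸ hw)⟩
  have step : ∀ φ : Sym2 V → Ω, G.IsProperEdgeColoring φ →
      (∀ w, w ≠ x → w ≠ y → G.incidentColors φ w = G.incidentColors φ₀ w) →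
      G.incidentColors φ x = G.incidentColors φ y →
      G.incidentColors φ x ∉ F.image (G.incidentColors φ₀) → ∀ (i : G.neighborSet x) (b : Ω),
      b ∉ Set.range (fun i : G.neighborSet x => φ s(x, i)) → v (φ s(x, i)) ≠ v b →
      (G.incidentColors φ x).image (Equiv.swap (φ s(x, i)) b) ∉ F.image (G.incidentColors φ₀) →
      ∃ φ' : Sym2 V → Ω, G.IsProperEdgeColoring φ' ∧
      (∀ w, w ≠ x → w ≠ y → G.incidentColors φ' w = G.incidentColors φ₀ w) ∧
      G.incidentColors φ' x = (G.incidentColors φ x).image (Equiv.swap (φ s(x, i)) b) ∧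
      G.incidentColors φ' y = (G.incidentColors φ x).image (Equiv.swap (φ s(x, i)) b) ∧
      (∀ v, G.Adj x v → φ' s(x, v) = Equiv.swap (φ s(x, i)) b (φ s(x, v))) ∧
      (i.1 ≠ y → b ∈ G.incidentColors φ₀ i) := by
    intro φ hφ h0 hS hSF i b hb hv hB
    have hb' : b ∉ G.incidentColors φ x := by
      rw [← him]
      simpa using hb
    have hF0 : ∀ w ∈ F, G.incidentColors φ w = G.incidentColors φ₀ w := fun w hw =>
      h0 w (hF w hw).1 (hF w hw).2
    have hFm : ∀ w ∈ F, G.incidentColors φ w ∈ F.image (G.incidentColors φ₀) := fun w hw =>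
      hF0 w hw ▸ Finset.mem_image_of_mem _ hw
    obtain ⟨φ', h1, h2, h3, h4, h5, h6⟩ := hφ.exists_recoloring (F := F) hxy hS
      (fun w hw e => hSF (e ▸ hFm w hw))
      (fun w hw w' hw' e => hinj hw hw' (by rw [← hF0 w hw, ← hF0 w' hw', e]))
      (mem_incidentColors.mpr ⟨i, i.2, rfl⟩) hb'
      (fun w hw w' hw' ho e => Finset.sum_image_swap_ne hv ho (by
        rw [← e]
        refine hsum _ (hFm w' hw') _ (hFm w hw) ?_
        rw [e, Finset.card_image_of_injective _ (Equiv.injective _)]))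
      (fun w hw e => hB (e ▸ hFm w hw)) hstuck
    refine ⟨φ', h1, fun w hx hy => (h2 w hx hy).trans (h0 w hx hy), h3, h4, h5, fun hi => ?_⟩
    rw [← h0 i i.2.ne' hi]
    refine (h6 i i.2 rfl hi).mp (mem_incidentColors.mpr ⟨x, i.2.symm, ?_⟩)
    rw [Sym2.eq_swap]
  have hupd : ∀ φ : Sym2 V → Ω, G.IsProperEdgeColoring φ → ∀ (i : G.neighborSet x) (b : Ω),
      b ∉ Set.range (fun i : G.neighborSet x => φ s(x, i)) →
      Finset.univ.image (update (fun i : G.neighborSet x => φ s(x, i)) i b) =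
      (G.incidentColors φ x).image (Equiv.swap (φ s(x, i)) b) := by
    intro φ hφ i b hb
    rw [update_eq_swap_comp (injc φ hφ) i hb, ← Finset.image_image, him]
  constructor
  · exact hf
  · exact hspan
  · intro c c' e hc
    convert hc using 1
    ext t
    have := Set.ext_iff.mp e t
    simpa using this.symm
  · intro c c' hc hc' hB hB'
    rw [← Finset.sum_image (f := v) hc.injOn, ← Finset.sum_image (f := v) hc'.injOn]
    refine hsum _ hB _ hB' ?_
    rw [Finset.card_image_of_injective _ hc, Finset.card_image_of_injective _ hc']
  · rintro c ⟨φ, hφ, -, -, -, rfl⟩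
    exact injc φ hφ
  · rintro c ⟨φ, hφ, -, -, hSF, rfl⟩
    rwa [him]
  · rintro c i ⟨φ, hφ, h0, -, -, rfl⟩ hi hM
    apply hM
    rw [← h0 i i.2.ne' hi]
    exact mem_incidentColors.mpr ⟨x, i.2.symm, by rw [Sym2.eq_swap]⟩
  · rintro c i b ⟨φ, hφ, h0, hS, hSF, rfl⟩ hb hv hB
    rw [hupd φ hφ i b hb] at hB
    obtain ⟨φ', h1, h2, h3, h4, h5, -⟩ := step φ hφ h0 hS hSF i b hb hv hB
    refine ⟨φ', h1, h2, h3.trans h4.symm, h3 ▸ hB, ?_⟩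
    rw [update_eq_swap_comp (injc φ hφ) i hb]
    exact funext fun j => (h5 j j.2).symm
  · rintro c i γ ⟨φ, hφ, h0, hS, hSF, rfl⟩ hi hγ hγc hv
    by_contra hB
    rw [hupd φ hφ i γ hγc] at hB
    obtain ⟨φ', -, -, -, -, -, h6⟩ := step φ hφ h0 hS hSF i γ hγc hv hB
    exact hγ (h6 hi)

end SimpleGraph

namespace SimpleGraph

variable {V : Type*} {G : SimpleGraph V} [Fintype V] [DecidableRel G.Adj]

/-- A graph on `n` vertices has a proper coloring with `n + 1` colors. -/
theorem exists_isProperEdgeColoring (G : SimpleGraph V) :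
    ∃ φ : Sym2 V → Fin (Fintype.card V + 1), G.IsProperEdgeColoring φ := by
  classical
  let e := Fintype.equivFin V
  let g : V → ZMod (Fintype.card V + 1) := fun u => ((e u : ℕ) : ZMod (Fintype.card V + 1))
  have hg : Function.Injective g := by
    intro u v huv
    apply e.injective
    apply Fin.ext
    have := (ZMod.natCast_eq_natCast_iff' _ _ _).mp huv
    rwa [Nat.mod_eq_of_lt (by omega), Nat.mod_eq_of_lt (by omega)] at this
  let φ : Sym2 V → ZMod (Fintype.card V + 1) :=
    Sym2.lift ⟨fun u v => g u + g v, fun u v => add_comm _ _⟩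
  have hφ : G.IsProperEdgeColoring φ := fun u v w _ _ e => hg (add_left_cancel e)
  exact ⟨φ, hφ⟩

/-- A coloring distinguishing the vertices in `U` can be replaced by one that in addition
distinguishes one more vertex. -/
theorem exists_injOn_insert
    (hiso : {v : V | G.degree v = 0}.Subsingleton)
    (hedge : ¬ ∃ u v : V, G.Adj u v ∧ G.degree u = 1 ∧ G.degree v = 1)
    {U : Set V} {x : V} (hxU : x ∉ U) {φ₀ : Sym2 V → Fin (Fintype.card V + 1)}
    (hφ₀ : G.IsProperEdgeColoring φ₀) (hU : Set.InjOn (G.incidentColors φ₀) U) :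
    ∃ φ : Sym2 V → Fin (Fintype.card V + 1), G.IsProperEdgeColoring φ ∧
      Set.InjOn (G.incidentColors φ) (insert x U) := by
  classical
  by_contra! hstuck
  obtain ⟨y, hyU, hxy⟩ : ∃ y ∈ U, G.incidentColors φ₀ x = G.incidentColors φ₀ y := by
    by_contra! hno
    refine hstuck φ₀ hφ₀ ((Set.injOn_insert hxU).mpr ⟨hU, ?_⟩)
    rintro ⟨y, hy, e⟩
    exact hno y hy e.symm
  have hne : x ≠ y := fun e => hxU (e ▸ hyU)
  have hcard := Fintype.card_fin (Fintype.card V + 1)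
  have hdeg : G.degree x = G.degree y := by
    rw [← hφ₀.card_incidentColors, ← hφ₀.card_incidentColors, hxy]
  have hd0 : G.degree x ≠ 0 := fun e => hne (hiso e (hdeg.symm.trans e))
  let F : Finset V := (U \ {y}).toFinset
  have hFm : ∀ w, w ∈ F ↔ w ∈ U ∧ w ≠ y := by simp [F]
  have hFU : (insert y F : Set V) = U := by
    ext w
    simp only [Set.mem_insert_iff, Finset.mem_coe, hFm]
    constructor
    · rintro (rfl | h)
      · exact hyU
      · exact h.1
    · tauto
  have hxF : x ∉ F := fun h => hxU ((hFm x).mp h).1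
  have hyF : y ∉ F := fun h => ((hFm y).mp h).2 rfl
  have hFcard : F.card + 2 ≤ Fintype.card V := by
    have := Finset.card_le_univ (insert x (insert y F))
    rwa [Finset.card_insert_of_notMem (by simp [hne, hxF]),
      Finset.card_insert_of_notMem hyF] at this
  have hlt : ∀ w, G.degree w < Fintype.card V := fun w => G.degree_lt_card_verts w
  have hnbr : G.degree x = 1 → ∀ z, G.Adj x z → z ≠ y := by
    rintro h1 z hz rfl
    exact hedge ⟨x, z, hz, h1, hdeg ▸ h1⟩
  have h3 : 3 ≤ Fintype.card V := by
    by_contra hlt3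
    have h1 : G.degree x = 1 := by
      have := hlt x
      omega
    obtain ⟨z, hz⟩ := (G.degree_pos_iff_exists_adj x).mp (Nat.pos_of_ne_zero hd0)
    have : ({x, y, z} : Finset V).card = 3 :=
      Finset.card_eq_three.mpr ⟨_, _, _, hne, hz.ne, (hnbr h1 z hz).symm, rfl⟩
    have := Finset.card_le_univ ({x, y, z} : Finset V)
    omega
  have himg : (F.image (G.incidentColors φ₀)).card ≤ F.card := Finset.card_image_le
  obtain ⟨Q, _, _, v, f, hf, hspan, hsum⟩ :=
    exists_weights (F.image (G.incidentColors φ₀)) (by omega) (by omega)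
  have game := IsProperEdgeColoring.slidingGame (G := G) hne hxF hyF
    (hU.mono fun w hw => ((hFm w).mp hw).1) (fun φ hφ => hFU ▸ hstuck φ hφ) hf hspan hsum
  have hstart : ∃ φ : Sym2 V → Fin (Fintype.card V + 1), G.IsProperEdgeColoring φ ∧
      (∀ w, w ≠ x → w ≠ y → G.incidentColors φ w = G.incidentColors φ₀ w) ∧
      G.incidentColors φ x = G.incidentColors φ y ∧
      G.incidentColors φ x ∉ F.image (G.incidentColors φ₀) ∧
      (fun i : G.neighborSet x => φ₀ s(x, i.1)) = fun i => φ s(x, i.1) := by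
    refine ⟨φ₀, hφ₀, fun _ _ _ => rfl, hxy, ?_, rfl⟩
    rw [Finset.mem_image]
    rintro ⟨w, hw, e⟩
    obtain ⟨hwU, hwy⟩ := (hFm w).mp hw
    exact hwy (hU hwU hyU (e.trans hxy))
  have hcD : Fintype.card (G.neighborSet x) = G.degree x := G.card_neighborSet_eq_degree x
  by_cases hd1 : G.degree x = 1
  · obtain ⟨z, hz⟩ := (G.degree_pos_iff_exists_adj x).mp (Nat.pos_of_ne_zero hd0)
    have hzy := hnbr hd1 z hz
    let i : G.neighborSet x := ⟨z, hz⟩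
    have : Subsingleton (G.neighborSet x) :=
      Fintype.card_le_one_iff_subsingleton.mp (by omega)
    have hleaf : ∀ γ, γ ∉ G.incidentColors φ₀ z → ∃ w ∈ F, G.incidentColors φ₀ w = {γ} := by
      intro γ hγ
      have := game.blocked_of_subsingleton hstart (i := i) hzy hγ
      obtain ⟨w, hw, e⟩ := Finset.mem_image.mp this
      refine ⟨w, hw, e.trans ?_⟩
      ext t
      simp only [Finset.mem_image, Finset.mem_univ, true_and, Finset.mem_singleton]
      constructor
      · rintro ⟨j, rfl⟩
        rw [Subsingleton.elim j i, Function.update_self]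
      · rintro rfl
        exact ⟨i, Function.update_self _ _ _⟩
    have : Nonempty V := ⟨x⟩
    choose! g hgF hg using hleaf
    have hginj : Set.InjOn g (G.incidentColors φ₀ z : Set (Fin (Fintype.card V + 1)))ᶜ := by
      intro γ hγ γ' hγ' e
      have := hg γ hγ
      rw [e, hg γ' hγ'] at this
      exact (Finset.singleton_injective this).symm
    let L := (G.incidentColors φ₀ z)ᶜ.image g
    have hL : L.card = Fintype.card V + 1 - G.degree z := by
      rw [Finset.card_image_of_injOn (by simpa using hginj), Finset.card_compl,
        hφ₀.card_incidentColors, Fintype.card_fin]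
    have hdisj : Disjoint L (insert z (G.neighborFinset z)) := by
      rw [Finset.disjoint_left]
      intro w hw hwz
      obtain ⟨γ, hγ, rfl⟩ := Finset.mem_image.mp hw
      rw [Finset.mem_compl] at hγ
      rcases Finset.mem_insert.mp hwz with e | e
      · have := hg γ hγ
        rw [e] at this
        exact hγ (this ▸ Finset.mem_singleton_self γ)
      · have hadj : G.Adj z (g γ) := by simpa using e
        have h1 : φ₀ s(z, g γ) ∈ G.incidentColors φ₀ (g γ) :=
          mem_incidentColors.mpr ⟨z, hadj.symm, by rw [Sym2.eq_swap]⟩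
        rw [hg γ hγ, Finset.mem_singleton] at h1
        exact hγ (h1 ▸ mem_incidentColors.mpr ⟨_, hadj, rfl⟩)
    have h4 := Finset.card_le_univ (L ∪ insert z (G.neighborFinset z))
    rw [Finset.card_union_of_disjoint hdisj, Finset.card_insert_of_notMem (by simp),
      card_neighborFinset_eq_degree] at h4
    have := hlt z
    omega
  · have hD : ∀ i : G.neighborSet x, ∃ j, j ≠ i := by
      have : Nontrivial (G.neighborSet x) := Fintype.one_lt_card_iff_nontrivial.mp (by omega)
      exact exists_ne
    have : Nonempty (G.neighborSet x) := Fintype.card_pos_iff.mp (by omega)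
    refine game.false_of_reachable hD ?_ ?_ ?_ hstart
    · intro c a
      by_contra! hno
      have h1 : (Finset.univ : Finset (Fin (Fintype.card V + 1))) ⊆
          insert a (Finset.univ.image c) := by
        intro b _
        by_cases hb : b ∈ Set.range c
        · exact Finset.mem_insert_of_mem (by simpa using hb)
        · exact hno b hb ▸ Finset.mem_insert_self _ _
      have h2 := Finset.card_le_card h1
      have h3 := Finset.card_insert_le a (Finset.univ.image c)
      have h4 : (Finset.univ.image c).card ≤ _ := Finset.card_image_le
      rw [Finset.card_univ] at h2 h4
      have := hlt x
      omega
    · intro i _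
      by_contra hno
      have h1 : G.incidentColors φ₀ i = Finset.univ := by
        ext t
        simp only [Finset.mem_univ, iff_true]
        by_contra ht
        exact hno ⟨t, ht⟩
      have h2 := hφ₀.card_incidentColors i
      rw [h1, Finset.card_univ] at h2
      have := hlt i
      omega
    · intro i l hil
      by_contra! hno
      exact hil (Subtype.ext (hno.1.trans hno.2.symm))

/-- A graph without isolated edges and with at most one isolated vertex has a proper coloring with
`n + 1` colors distinguishing all vertices. -/
theorem exists_injective_incidentColors
    (hiso : {v : V | G.degree v = 0}.Subsingleton)
    (hedge : ¬ ∃ u v : V, G.Adj u v ∧ G.degree u = 1 ∧ G.degree v = 1) :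
    ∃ φ : Sym2 V → Fin (Fintype.card V + 1), G.IsProperEdgeColoring φ ∧
      Function.Injective (G.incidentColors φ) := by
  classical
  have key : ∀ U : Finset V, ∃ φ : Sym2 V → Fin (Fintype.card V + 1),
      G.IsProperEdgeColoring φ ∧ Set.InjOn (G.incidentColors φ) U := by
    intro U
    induction U using Finset.induction_on with
    | empty =>
      obtain ⟨φ, hφ⟩ := G.exists_isProperEdgeColoring
      exact ⟨φ, hφ, by simp⟩
    | insert x U hx ih =>
      obtain ⟨φ, hφ, hU⟩ := ih
      rw [Finset.coe_insert]
      exact exists_injOn_insert hiso hedge (by simpa using hx) hφ hU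
  obtain ⟨φ, hφ, hU⟩ := key Finset.univ
  exact ⟨φ, hφ, by simpa [Set.injOn_univ] using hU⟩

end SimpleGraph

/-- Every vdec graph `G` satisfies `χ'_vd(G) ≤ |V(G)| + 1`; that is, it admits a
vertex-distinguishing edge-(|V(G)|+1)-coloring. -/
theorem vdIndex_le_card_add_one {V : Type*} [Fintype V] (G : SimpleGraph V) [DecidableRel G.Adj]
    (h : IsVdecGraph G) :
    vdIndex G ≤ Fintype.card V + 1 ∧
    ∃ φ : Sym2 V → ℕ, IsVDEC G (Fintype.card V + 1) φ := by
  suffices hex : ∃ φ : Sym2 V → ℕ, IsVDEC G (Fintype.card V + 1) φ from ⟨Nat.sInf_le hex, hex⟩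
  obtain ⟨φ, hφ, hinj⟩ := G.exists_injective_incidentColors h.1 h.2
  have hcs : ∀ u, colorSet G (fun e => (φ e : ℕ) + 1) u =
      (fun a : Fin (Fintype.card V + 1) => (a : ℕ) + 1) '' (G.incidentColors φ u) := by
    intro u
    ext c
    simp only [colorSet, Set.mem_ofPred_eq, Set.mem_image, Finset.mem_coe,
      SimpleGraph.mem_incidentColors]
    constructor
    · rintro ⟨e, he, hu, rfl⟩
      obtain ⟨w, rfl⟩ := hu
      exact ⟨_, ⟨w, he, rfl⟩, rfl⟩
    · rintro ⟨_, ⟨w, hw, rfl⟩, rfl⟩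
      exact ⟨s(u, w), hw, Sym2.mem_mk_left _ _, rfl⟩
  refine ⟨fun e => (φ e : ℕ) + 1, ⟨fun e _ => ?_, ?_⟩, fun u v huv e => huv (hinj ?_)⟩
  · exact Finset.mem_Icc.mpr ⟨Nat.succ_pos _, Nat.succ_le_of_lt (φ e).isLt⟩
  · rintro e₁ h₁ e₂ h₂ hne ⟨u, ⟨v, rfl⟩, ⟨w, rfl⟩⟩ e
    apply hne
    rw [hφ u v w h₁ h₂ (Fin.ext (Nat.succ_injective e))]
  · rw [hcs, hcs] at e
    exact Finset.coe_injective
      (Set.image_injective.mpr (fun a b hab => Fin.ext (Nat.succ_injective hab)) e)
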